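/- Measure-independent bound for the centered weighted fractional maximal function: Let 0 ≤ α < n, let ν be a positive Borel measure on ℝⁿ, and let 1 < p ≤ q < ∞ satisfy 1/p − 1/q = α/n. Then there is a constant c depending only on n and p (in particular independent of ν) such that ‖M^c_{α,ν} f‖_{L^q(ν)} ≤ c ‖f‖_{L^p(ν)} for all f ∈ L^p(ν). -/

import Mathlib

open MeasureTheory ENNReal Set

noncomputable section

/-- Euclidean space `ℝⁿ`. -/
abbrev Euc (n : ℕ) := EuclideanSpace ℝ (Fin n)

variable {n : ℕ}

/-- The axis-parallel closed cube with lower corner `a` and side length `h`. -/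
def Cube (a : Euc n) (h : ℝ) : Set (Euc n) :=
  {x | ∀ i, a i ≤ x i ∧ x i ≤ a i + h}

/-- The weighted measure `u(E) = ∫_E u dx` of a set. -/
def wMeas (u : Euc n → ℝ) (E : Set (Euc n)) : ℝ≥0∞ :=
  ∫⁻ x in E, ENNReal.ofReal (u x)

/-- The dual exponent `p' = p/(p-1)`. -/
def dualExp (p : ℝ) : ℝ := p / (p - 1)

/-- The `A_{p,q}` constant of a weight `w` (with the `A_{1,q}` convention when `p = 1`). -/
def Apq (p q : ℝ) (w : Euc n → ℝ) : ℝ≥0∞ :=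
  ⨆ (a : Euc n) (h : ℝ) (_ : 0 < h),
    ((volume (Cube a h))⁻¹ * ∫⁻ x in Cube a h, ENNReal.ofReal (w x) ^ q) *
      (if p = 1 then
        (essSup (fun x => (ENNReal.ofReal (w x))⁻¹) (volume.restrict (Cube a h))) ^ q
      else
        ((volume (Cube a h))⁻¹ * ∫⁻ x in Cube a h,
            ENNReal.ofReal (w x) ^ (-(dualExp p))) ^ (q / dualExp p))

/-- The weighted Lebesgue norm `‖w f‖_{L^p(ℝⁿ)}`. -/
def wLp (w f : Euc n → ℝ) (p : ℝ) : ℝ≥0∞ :=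
  (∫⁻ x, (ENNReal.ofReal (w x) * ENNReal.ofReal |f x|) ^ p) ^ (1 / p)

/-- The weighted Lebesgue norm `‖w g‖_{L^q(ℝⁿ)}` of an `ℝ≥0∞`-valued function. -/
def wLpE (w : Euc n → ℝ) (g : Euc n → ℝ≥0∞) (q : ℝ) : ℝ≥0∞ :=
  (∫⁻ x, (ENNReal.ofReal (w x) * g x) ^ q) ^ (1 / q)

/-- The weak norm `‖g‖_{L^{q,∞}(u)} = sup_{λ>0} λ u({|g|>λ})^{1/q}`. -/
def weakLp (u : Euc n → ℝ) (g : Euc n → ℝ) (q : ℝ) : ℝ≥0∞ :=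
  ⨆ (t : ℝ) (_ : 0 < t), ENNReal.ofReal t * wMeas u {x | t < |g x|} ^ (1 / q)

/-- The weak norm of an `ℝ≥0∞`-valued function. -/
def weakLpE (u : Euc n → ℝ) (g : Euc n → ℝ≥0∞) (q : ℝ) : ℝ≥0∞ :=
  ⨆ (t : ℝ) (_ : 0 < t), ENNReal.ofReal t * wMeas u {x | ENNReal.ofReal t < g x} ^ (1 / q)

/-- The fractional integral (Riesz potential) `I_α f(x) = ∫ |f(y)| |x-y|^{α-n} dy`. -/
def riesz (α : ℝ) (f : Euc n → ℝ) (x : Euc n) : ℝ≥0∞ :=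
  ∫⁻ y, ENNReal.ofReal |f y| * ENNReal.ofReal (‖x - y‖ ^ (α - (n : ℝ)))

/-- The fractional maximal operator `M_α f(x) = sup_{Q ∋ x} |Q|^{α/n-1} ∫_Q |f|`. -/
def fracMax (α : ℝ) (f : Euc n → ℝ) (x : Euc n) : ℝ≥0∞ :=
  ⨆ (a : Euc n) (h : ℝ) (_ : 0 < h) (_ : x ∈ Cube a h),
    volume (Cube a h) ^ (α / (n : ℝ) - 1) * ∫⁻ y in Cube a h, ENNReal.ofReal |f y|


/-- The axis-parallel closed cube centered at `x` with side length `h`. -/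
def CCube (x : Euc n) (h : ℝ) : Set (Euc n) :=
  {y | ∀ i, |y i - x i| ≤ h / 2}

/-- The centered weighted fractional maximal function `M^c_{α,ν} f`. -/
def cFracMax (α : ℝ) (ν : Measure (Euc n)) (f : Euc n → ℝ) (x : Euc n) : ℝ≥0∞ :=
  ⨆ (h : ℝ) (_ : 0 < h),
    ν (CCube x h) ^ (α / (n : ℝ) - 1) * ∫⁻ y in CCube x h, ENNReal.ofReal |f y| ∂ν


lemma ccube_eq (x : Euc n) {h : ℝ} (hh : 0 ≤ h) :
    CCube x h = (fun y : Euc n => WithLp.ofLp y) ⁻¹'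
      (Metric.closedBall (WithLp.ofLp x : Fin n → ℝ) (h / 2)) := by
  ext y
  simp only [CCube, mem_ofPred_eq, mem_preimage, Metric.mem_closedBall]
  rw [dist_pi_le_iff (by positivity)]
  simp [Real.dist_eq]

lemma ccube_meas (x : Euc n) {h : ℝ} (hh : 0 ≤ h) : MeasurableSet (CCube x h) := by
  rw [ccube_eq x hh]
  have hc : Continuous (fun y : Euc n => WithLp.ofLp y) := by fun_prop
  exact (Metric.isClosed_closedBall.preimage hc).measurableSet

/-- Besicovitch covering bound, bounded radii. -/
lemma weak_bounded {N : ℕ} {τ : ℝ} (hτ : 1 < τ)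
    (hN : IsEmpty (Besicovitch.SatelliteConfig (Fin n → ℝ) N τ))
    (ν μ : Measure (Euc n)) (t : ℝ≥0∞) (A : Set (Euc n)) (R : ℝ)
    (hA : ∀ x ∈ A, ∃ h : ℝ, 0 < h ∧ h ≤ R ∧ t * ν (CCube x h) ≤ μ (CCube x h)) :
    t * ν A ≤ N * μ univ := by
  choose! h hpos hR hle using hA
  let P : Besicovitch.BallPackage A (Fin n → ℝ) :=
    { c := fun x => WithLp.ofLp x.1
      r := fun x => h x.1 / 2
      rpos := fun x => by have := hpos x.1 x.2; positivity
      r_bound := R / 2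
      r_le := fun x => by have := hR x.1 x.2; linarith }
  obtain ⟨s, hs, hcov⟩ := Besicovitch.exist_disjoint_covering_families hτ hN P
  have hcount : ∀ i, (s i).Countable := by
    intro i
    refine (hs i).countable_of_nonempty_interior fun j _ => ?_
    have : (Metric.ball (P.c j) (P.r j)).Nonempty := Metric.nonempty_ball.2 (P.rpos _)
    exact this.mono Metric.ball_subset_interior_closedBall
  have hcube : ∀ j : A, CCube j.1 (h j.1) = (fun y : Euc n => WithLp.ofLp y) ⁻¹'
      (Metric.closedBall (P.c j) (P.r j)) := fun j => ccube_eq j.1 (hpos j.1 j.2).le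
  have hsub : A ⊆ ⋃ i : Fin N, ⋃ j ∈ s i, CCube j.1 (h j.1) := by
    intro x hx
    have := hcov (mem_range_self (⟨x, hx⟩ : A))
    simp only [mem_iUnion] at this ⊢
    obtain ⟨i, j, hj, hm⟩ := this
    refine ⟨i, j, hj, ?_⟩
    rw [hcube]
    exact Metric.ball_subset_closedBall hm
  have hone : ∀ i : Fin N, t * ν (⋃ j ∈ s i, CCube j.1 (h j.1)) ≤ μ univ := by
    intro i
    calc t * ν (⋃ j ∈ s i, CCube j.1 (h j.1))
        ≤ t * ∑' j : s i, ν (CCube j.1.1 (h j.1.1)) := by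
          gcongr
          exact measure_biUnion_le _ (hcount i) _
      _ = ∑' j : s i, t * ν (CCube j.1.1 (h j.1.1)) := ENNReal.tsum_mul_left.symm
      _ ≤ ∑' j : s i, μ (CCube j.1.1 (h j.1.1)) :=
          ENNReal.tsum_le_tsum fun j => hle _ j.1.2
      _ = μ (⋃ j ∈ s i, CCube j.1 (h j.1)) := by
          rw [measure_biUnion (hcount i)]
          · intro a ha b hb hab
            have := hs i ha hb hab
            simp only [Function.onFun] at this ⊢
            rw [hcube, hcube]
            exact this.preimage _
          · intro j _
            exact ccube_meas _ (hpos j.1 j.2).le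
      _ ≤ μ univ := measure_mono (subset_univ _)
  calc t * ν A ≤ t * ∑ i : Fin N, ν (⋃ j ∈ s i, CCube j.1 (h j.1)) := by
        gcongr
        exact (measure_mono hsub).trans (measure_iUnion_fintype_le _ _)
    _ = ∑ i : Fin N, t * ν (⋃ j ∈ s i, CCube j.1 (h j.1)) := Finset.mul_sum _ _ _
    _ ≤ ∑ i : Fin N, μ univ := Finset.sum_le_sum fun i _ => hone i
    _ = N * μ univ := by simp

/-- Besicovitch covering bound. -/
lemma weak_gen {N : ℕ} {τ : ℝ} (hτ : 1 < τ)
    (hN : IsEmpty (Besicovitch.SatelliteConfig (Fin n → ℝ) N τ))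
    (ν μ : Measure (Euc n)) (t : ℝ≥0∞) (A : Set (Euc n))
    (hA : ∀ x ∈ A, ∃ h : ℝ, 0 < h ∧ t * ν (CCube x h) ≤ μ (CCube x h)) :
    t * ν A ≤ N * μ univ := by
  let B : ℕ → Set (Euc n) := fun k =>
    {x | x ∈ A ∧ ∃ h : ℝ, 0 < h ∧ h ≤ k ∧ t * ν (CCube x h) ≤ μ (CCube x h)}
  have hmono : Monotone B := by
    intro a b hab x hx
    obtain ⟨h1, h, h2, h3, h4⟩ := hx
    exact ⟨h1, h, h2, h3.trans (by exact_mod_cast hab), h4⟩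
  have hU : A = ⋃ k, B k := by
    ext x
    simp only [mem_iUnion]
    constructor
    · intro hx
      obtain ⟨h, h1, h2⟩ := hA x hx
      obtain ⟨k, hk⟩ := exists_nat_ge h
      exact ⟨k, hx, h, h1, hk, h2⟩
    · rintro ⟨k, hk⟩
      exact hk.1
  rw [hU, hmono.measure_iUnion, ENNReal.mul_iSup]
  exact iSup_le fun k => weak_bounded hτ hN ν μ t (B k) k fun x hx => hx.2

lemma weak_type {N : ℕ} {τ : ℝ} (hτ : 1 < τ)
    (hN : IsEmpty (Besicovitch.SatelliteConfig (Fin n → ℝ) N τ))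
    (ν : Measure (Euc n)) (f : Euc n → ℝ) (hf : Measurable f) (t : ℝ) (ht : 0 < t) :
    ENNReal.ofReal t * ν {x | ENNReal.ofReal (2 * t) < cFracMax 0 ν f x} ≤
      N * (ν.withDensity fun x => ENNReal.ofReal |f x|) {x | t < |f x|} := by
  have hS : MeasurableSet {x | t < |f x|} :=
    measurableSet_lt measurable_const (by fun_prop)
  have key := weak_gen hτ hN ν
    ((ν.withDensity fun x => ENNReal.ofReal |f x|).restrict {x | t < |f x|})
    (ENNReal.ofReal t) {x | ENNReal.ofReal (2 * t) < cFracMax 0 ν f x} ?_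
  · rwa [Measure.restrict_apply_univ] at key
  intro x hx
  simp only [mem_ofPred_eq, cFracMax, lt_iSup_iff] at hx
  obtain ⟨h, hh, hx⟩ := hx
  refine ⟨h, hh, ?_⟩
  have hQ := ccube_meas x hh.le
  rw [Measure.restrict_apply hQ, withDensity_apply _ (hQ.inter hS)]
  rw [zero_div, zero_sub, ENNReal.rpow_neg_one] at hx
  set V := ν (CCube x h) with hV
  have hVtop : V ≠ ⊤ := by
    intro h0
    simp [h0] at hx
  have hV0 : V ≠ 0 := by
    intro h0
    rw [setLIntegral_measure_zero _ _ h0] at hx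
    simp at hx
  have h1 : ENNReal.ofReal (2 * t) * V ≤ ∫⁻ y in CCube x h, ENNReal.ofReal |f y| ∂ν := by
    calc ENNReal.ofReal (2 * t) * V
        ≤ (V⁻¹ * ∫⁻ y in CCube x h, ENNReal.ofReal |f y| ∂ν) * V := by gcongr
      _ = (V⁻¹ * V) * ∫⁻ y in CCube x h, ENNReal.ofReal |f y| ∂ν := by ring
      _ = _ := by rw [ENNReal.inv_mul_cancel hV0 hVtop, one_mul]
  have h2 : ∫⁻ y in CCube x h, ENNReal.ofReal |f y| ∂ν ≤
      ∫⁻ y in CCube x h ∩ {x | t < |f x|}, ENNReal.ofReal |f y| ∂ν + ENNReal.ofReal t * V := by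
    rw [← lintegral_inter_add_sdiff _ (CCube x h) hS]
    gcongr
    calc ∫⁻ y in CCube x h \ {x | t < |f x|}, ENNReal.ofReal |f y| ∂ν
        ≤ ∫⁻ y in CCube x h \ {x | t < |f x|}, ENNReal.ofReal t ∂ν := by
          refine setLIntegral_mono measurable_const fun y hy => ?_
          exact ENNReal.ofReal_le_ofReal (not_lt.1 hy.2)
      _ = ENNReal.ofReal t * ν (CCube x h \ {x | t < |f x|}) := by simp
      _ ≤ ENNReal.ofReal t * V := by
          gcongr
          exact measure_mono sdiff_subset
  have h3 : ENNReal.ofReal t * V ≠ ⊤ := ENNReal.mul_ne_top (by simp) hVtop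
  have h4 : ENNReal.ofReal (2 * t) * V = ENNReal.ofReal t * V + ENNReal.ofReal t * V := by
    rw [two_mul, ENNReal.ofReal_add ht.le ht.le, add_mul]
  rw [h4] at h1
  exact (ENNReal.add_le_add_iff_right h3).1 (h1.trans h2)

lemma strong_zero {N : ℕ} {τ : ℝ} (hτ : 1 < τ)
    (hN : IsEmpty (Besicovitch.SatelliteConfig (Fin n → ℝ) N τ))
    (p : ℝ) (hp : 1 < p) (ν : Measure (Euc n)) (f : Euc n → ℝ) (hf : Measurable f) :
    ∫⁻ x, cFracMax 0 ν f x ^ p ∂ν ≤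
      ENNReal.ofReal (2 ^ p * (p * N / (p - 1))) * ∫⁻ x, ENNReal.ofReal |f x| ^ p ∂ν := by
  have hp0 : 0 < p := by linarith
  have hp1 : 0 < p - 1 := by linarith
  rw [lintegral_eq_nnreal]
  refine iSup₂_le fun φ hφ => ?_
  rw [← SimpleFunc.lintegral_eq_lintegral]
  let ψ : Euc n → ℝ := fun x => (φ x : ℝ) ^ (1 / p) / 2
  have hψm : Measurable ψ := by
    have := φ.measurable
    fun_prop
  have hψ0 : ∀ x, 0 ≤ ψ x := fun x => by positivity
  have hφψ : ∀ x, ((φ x : NNReal) : ℝ≥0∞) = ENNReal.ofReal (2 ^ p) * ENNReal.ofReal (ψ x ^ p) := by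
    intro x
    rw [← ENNReal.ofReal_mul (by positivity), ← Real.mul_rpow (by positivity) (hψ0 x)]
    simp only [ψ]
    rw [mul_div_cancel₀ _ (by norm_num), ← Real.rpow_mul (by positivity),
      one_div_mul_cancel hp0.ne', Real.rpow_one, ENNReal.ofReal_coe_nnreal]
  have hsub : ∀ t : ℝ, 0 < t → {x | t < ψ x} ⊆ {x | ENNReal.ofReal (2 * t) < cFracMax 0 ν f x} := by
    intro t ht x hx
    simp only [mem_ofPred_eq] at hx ⊢
    have h1 : 2 * t < (φ x : ℝ) ^ (1 / p) := by
      simp only [ψ] at hx; linarith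
    have h2 : ENNReal.ofReal ((φ x : ℝ) ^ (1 / p)) ≤ cFracMax 0 ν f x := by
      rw [← ENNReal.ofReal_rpow_of_nonneg (by positivity) (by positivity),
        ENNReal.ofReal_coe_nnreal, one_div, ENNReal.rpow_inv_le_iff hp0]
      exact hφ x
    exact ((ENNReal.ofReal_lt_ofReal_iff (by linarith)).2 h1).trans_le h2
  set μ := ν.withDensity fun x => ENNReal.ofReal |f x| with hμ
  have hL := lintegral_rpow_eq_lintegral_meas_lt_mul ν (f := ψ) (.of_forall hψ0)
    hψm.aemeasurable hp0
  have hR := lintegral_rpow_eq_lintegral_meas_lt_mul μ (f := fun x => |f x|)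
    (.of_forall fun x => abs_nonneg _) (by fun_prop) hp1
  have hR2 : ∫⁻ x, ENNReal.ofReal (|f x| ^ (p - 1)) ∂μ = ∫⁻ x, ENNReal.ofReal |f x| ^ p ∂ν := by
    rw [hμ, lintegral_withDensity_eq_lintegral_mul _ (by fun_prop) (by fun_prop)]
    refine lintegral_congr fun x => ?_
    simp only [Pi.mul_apply]
    rw [← ENNReal.ofReal_mul (abs_nonneg _), ENNReal.ofReal_rpow_of_nonneg (abs_nonneg _) hp0.le]
    congr 1
    nth_rewrite 1 [← Real.rpow_one |f x|]
    rw [← Real.rpow_add_of_nonneg (abs_nonneg _) zero_le_one hp1.le]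
    congr 1; ring
  have hmid : ∫⁻ t in Ioi (0:ℝ), ν {a | t < ψ a} * ENNReal.ofReal (t ^ (p - 1)) ≤
      N * ∫⁻ t in Ioi (0:ℝ), μ {a | t < |f a|} * ENNReal.ofReal (t ^ (p - 1 - 1)) := by
    rw [← lintegral_const_mul' _ _ (by simp)]
    refine lintegral_mono_ae ?_
    filter_upwards [ae_restrict_mem measurableSet_Ioi] with t ht
    have ht : 0 < t := ht
    have e : ENNReal.ofReal (t ^ (p - 1)) = ENNReal.ofReal t * ENNReal.ofReal (t ^ (p - 1 - 1)) := by
      rw [← ENNReal.ofReal_mul ht.le]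
      congr 1
      rw [Real.rpow_sub_one ht.ne' (p - 1)]
      field_simp
    rw [e, ← mul_assoc, ← mul_assoc]
    refine mul_le_mul_left ?_ _
    rw [mul_comm]
    refine le_trans ?_ (weak_type hτ hN ν f hf t ht)
    exact mul_le_mul_right (measure_mono (hsub t ht)) _
  rw [hR2] at hR
  have hJ : ∫⁻ t in Ioi (0:ℝ), μ {a | t < |f a|} * ENNReal.ofReal (t ^ (p - 1 - 1)) =
      ENNReal.ofReal (1 / (p - 1)) * ∫⁻ x, ENNReal.ofReal |f x| ^ p ∂ν := by
    rw [hR, ← mul_assoc, ← ENNReal.ofReal_mul (by positivity), one_div_mul_cancel hp1.ne']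
    simp
  calc ∫⁻ x, (φ.map ((↑) : NNReal → ℝ≥0∞)) x ∂ν
      = ENNReal.ofReal (2 ^ p) * ∫⁻ x, ENNReal.ofReal (ψ x ^ p) ∂ν := by
        rw [← lintegral_const_mul' _ _ (by simp)]
        exact lintegral_congr fun x => by simpa using hφψ x
    _ ≤ ENNReal.ofReal (2 ^ p) * (ENNReal.ofReal p * (N * (ENNReal.ofReal (1 / (p - 1)) *
          ∫⁻ x, ENNReal.ofReal |f x| ^ p ∂ν))) := by
        rw [hL, ← hJ]
        gcongr
    _ = _ := by
        have : ENNReal.ofReal (2 ^ p * (p * N / (p - 1))) =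
            ENNReal.ofReal (2 ^ p) * (ENNReal.ofReal p * (N * ENNReal.ofReal (1 / (p - 1)))) := by
          rw [← ENNReal.ofReal_natCast, ← ENNReal.ofReal_mul (by positivity),
            ← ENNReal.ofReal_mul (by positivity), ← ENNReal.ofReal_mul (by positivity)]
          congr 1
          ring
        rw [this]
        ring

lemma pointwise_bound (hn : 0 < n) (p α q : ℝ) (hp : 1 < p) (hα : 0 ≤ α) (hαn : α < n)
    (hpq : p ≤ q) (h : 1 / p - 1 / q = α / n) (ν : Measure (Euc n)) (f : Euc n → ℝ)
    (hf : Measurable f) (x : Euc n) :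
    cFracMax α ν f x ≤ cFracMax 0 ν f x ^ (p / q) *
      (∫⁻ x, ENNReal.ofReal |f x| ^ p ∂ν) ^ (α / n) := by
  have hp0 : 0 < p := by linarith
  have hq0 : 0 < q := by linarith
  have hn' : (0 : ℝ) < n := by exact_mod_cast hn
  have ha1 : α / n - 1 < 0 := by
    have := (div_lt_one hn').2 hαn
    linarith
  refine iSup₂_le fun s hs => ?_
  have hle : ν (CCube x s) ^ (0 / (n : ℝ) - 1) * ∫⁻ y in CCube x s, ENNReal.ofReal |f y| ∂ν ≤
      cFracMax 0 ν f x :=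
    le_iSup₂ (f := fun (h : ℝ) (_ : 0 < h) =>
      ν (CCube x h) ^ (0 / (n : ℝ) - 1) * ∫⁻ y in CCube x h, ENNReal.ofReal |f y| ∂ν) s hs
  refine le_trans ?_ (mul_le_mul_left (ENNReal.rpow_le_rpow hle (by positivity)) _)
  rw [zero_div, zero_sub]
  have hhold : ∫⁻ y in CCube x s, ENNReal.ofReal |f y| ∂ν ≤
      (∫⁻ x, ENNReal.ofReal |f x| ^ p ∂ν) ^ (1 / p) * ν (CCube x s) ^ (1 - 1 / p) := by
    have hc := Real.HolderConjugate.conjExponent hp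
    have := ENNReal.lintegral_mul_le_Lp_mul_Lq (ν.restrict (CCube x s)) hc
      (f := fun y => ENNReal.ofReal |f y|) (g := fun _ => 1) (by fun_prop) (by fun_prop)
    simp only [Pi.mul_apply, mul_one, ENNReal.one_rpow, lintegral_const, one_mul,
      Measure.restrict_apply_univ] at this
    refine this.trans ?_
    have e : 1 / p.conjExponent = 1 - 1 / p := by
      have := hc.inv_add_inv_eq_one
      rw [one_div, one_div]; linarith
    rw [e]
    gcongr
    exact Measure.restrict_le_self
  set V := ν (CCube x s) with hV
  set F := ∫⁻ x, ENNReal.ofReal |f x| ^ p ∂ν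
  by_cases hV0 : V = 0
  · rw [setLIntegral_measure_zero _ _ hV0]; simp
  by_cases hVt : V = ⊤
  · rw [hVt, ENNReal.top_rpow_of_neg ha1]; simp
  set I := ∫⁻ y in CCube x s, ENNReal.ofReal |f y| ∂ν
  have hb : 0 ≤ 1 - p / q := by
    have := (div_le_one hq0).2 hpq
    linarith
  have hpq0 : 0 ≤ p / q := by positivity
  have hI : I = I ^ (p / q) * I ^ (1 - p / q) := by
    rw [← ENNReal.rpow_add_of_nonneg _ _ hpq0 hb]
    simp
  have hexpF : 1 / p * (1 - p / q) = α / n := by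
    rw [← h]; field_simp
  have hexpV : α / n - 1 + (1 - 1 / p) * (1 - p / q) = -1 * (p / q) := by
    rw [← h]; field_simp; ring
  calc V ^ (α / n - 1) * I = V ^ (α / n - 1) * (I ^ (p / q) * I ^ (1 - p / q)) := by rw [← hI]
    _ ≤ V ^ (α / n - 1) * (I ^ (p / q) * (F ^ (1 / p) * V ^ (1 - 1 / p)) ^ (1 - p / q)) := by
        gcongr
    _ = V ^ (α / n - 1) * (I ^ (p / q) * (F ^ (α / n) * V ^ ((1 - 1 / p) * (1 - p / q)))) := by
        rw [ENNReal.mul_rpow_of_nonneg _ _ hb, ← ENNReal.rpow_mul, ← ENNReal.rpow_mul, hexpF]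
    _ = (V ^ (α / n - 1) * V ^ ((1 - 1 / p) * (1 - p / q))) * I ^ (p / q) * F ^ (α / n) := by ring
    _ = (V ^ (-1 : ℝ) * I) ^ (p / q) * F ^ (α / n) := by
        rw [← ENNReal.rpow_add _ _ hV0 hVt, hexpV, ENNReal.mul_rpow_of_nonneg _ _ hpq0,
          ← ENNReal.rpow_mul]

/-- Measure-independent bound for the centered weighted fractional maximal
function (Lemma 4.1). -/
theorem cFracMax_measure_independent_bound
    (n : ℕ) (hn : 0 < n) (p : ℝ) (hp : 1 < p) :
    ∃ c : ℝ, 0 < c ∧ ∀ α q : ℝ, 0 ≤ α → α < n → p ≤ q → 1 / p - 1 / q = α / n →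
      ∀ (ν : Measure (Euc n)) (f : Euc n → ℝ), Measurable f →
      (∫⁻ x, cFracMax α ν f x ^ q ∂ν) ^ (1 / q) ≤
        ENNReal.ofReal c * (∫⁻ x, ENNReal.ofReal |f x| ^ p ∂ν) ^ (1 / p) := by
  obtain ⟨N, τ, hτ, hN⟩ :=
    HasBesicovitchCovering.no_satelliteConfig (α := Fin n → ℝ)
  have hp0 : 0 < p := by linarith
  have hp1 : 0 < p - 1 := by linarith
  set K : ℝ := 2 ^ p * (p * N / (p - 1)) with hK
  have hK0 : 0 ≤ K := by positivity
  refine ⟨K + 1, by positivity, ?_⟩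
  intro α q hα hαn hpq h ν f hf
  have hq0 : 0 < q := by linarith
  have hn' : (0 : ℝ) < n := by exact_mod_cast hn
  have hstrong := strong_zero hτ hN p hp ν f hf
  have hpt := pointwise_bound hn p α q hp hα hαn hpq h ν f hf
  set F := ∫⁻ x, ENNReal.ofReal |f x| ^ p ∂ν with hF
  by_cases hFt : F = ⊤
  · rw [hFt, ENNReal.top_rpow_of_pos (by positivity), ENNReal.mul_top]
    · exact le_top
    · simp; positivity
  have ha : 0 ≤ α / n := by positivity
  have hFa : (F ^ (α / n)) ^ q ≠ ⊤ :=
    ENNReal.rpow_ne_top_of_nonneg hq0.le (ENNReal.rpow_ne_top_of_nonneg ha hFt)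
  have h1 : ∫⁻ x, cFracMax α ν f x ^ q ∂ν ≤ ENNReal.ofReal K * F * (F ^ (α / n)) ^ q := by
    calc ∫⁻ x, cFracMax α ν f x ^ q ∂ν
        ≤ ∫⁻ x, cFracMax 0 ν f x ^ p * (F ^ (α / n)) ^ q ∂ν := by
          refine lintegral_mono fun x => ?_
          refine (ENNReal.rpow_le_rpow (hpt x) hq0.le).trans ?_
          rw [ENNReal.mul_rpow_of_nonneg _ _ hq0.le, ← ENNReal.rpow_mul,
            div_mul_cancel₀ _ hq0.ne']
      _ = (∫⁻ x, cFracMax 0 ν f x ^ p ∂ν) * (F ^ (α / n)) ^ q := lintegral_mul_const' _ _ hFa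
      _ ≤ _ := by gcongr
  have hq1 : 0 ≤ 1 / q := by positivity
  have hq2 : 1 / q ≤ 1 := by
    rw [div_le_one hq0]; linarith
  have hKle : ENNReal.ofReal K ^ (1 / q) ≤ ENNReal.ofReal (K + 1) := by
    calc ENNReal.ofReal K ^ (1 / q) ≤ ENNReal.ofReal (K + 1) ^ (1 / q) := by
          gcongr; linarith
      _ ≤ ENNReal.ofReal (K + 1) ^ (1 : ℝ) := by
          refine ENNReal.rpow_le_rpow_of_exponent_le ?_ hq2
          rw [ENNReal.one_le_ofReal]; linarith
      _ = _ := ENNReal.rpow_one _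
  calc (∫⁻ x, cFracMax α ν f x ^ q ∂ν) ^ (1 / q)
      ≤ (ENNReal.ofReal K * F * (F ^ (α / n)) ^ q) ^ (1 / q) := by gcongr
    _ = ENNReal.ofReal K ^ (1 / q) * F ^ (1 / p) := by
        rw [ENNReal.mul_rpow_of_nonneg _ _ hq1, ENNReal.mul_rpow_of_nonneg _ _ hq1,
          ← ENNReal.rpow_mul (F ^ (α / n)), mul_one_div_cancel hq0.ne', ENNReal.rpow_one, mul_assoc,
          ← ENNReal.rpow_add_of_nonneg _ _ hq1 ha]
        congr 2
        linarith
    _ ≤ _ := by gcongr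

end
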